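/- arXiv:1603.00893 — 4 statements merged into one kernel-verified Lean document; each statement's English description precedes it below -/
import Mathlib

section
/- Let X and Y be two distinct maximal attribute sets (MASs) of a dataset D. Then for every equivalence class C of the partition π_X and every equivalence class C' of the partition π_Y, C and C' share at most one record, i.e., |C ∩ C'| ≤ 1. Equivalently, no two distinct records of D agree on X ∪ Y. (Paper's Theorem on overlapping MASs, th:inter.) -/
/-- An attribute set `X` is a maximal attribute set (MAS) of the dataset `t`:
(1) some two distinct records agree on `X`, and (2) for every strictly larger
attribute set, no two distinct records agree on it. -/
def IsMAS {ι Attr V : Type*} (t : ι → Attr → V) (X : Finset Attr) : Prop :=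
  (∃ i j : ι, i ≠ j ∧ ∀ A ∈ X, t i A = t j A) ∧
  ∀ X' : Finset Attr, X ⊂ X' → ¬ ∃ i j : ι, i ≠ j ∧ ∀ A ∈ X', t i A = t j A

/-- Paper's Theorem (th:inter): equivalence classes of two distinct MASs `X` and
`Y` share at most one record; equivalently, no two distinct records agree on
`X ∪ Y`. -/
theorem overlapping_mas_ecs_share_at_most_one_record
    {ι Attr V : Type*} [Fintype ι] [Fintype Attr] [DecidableEq Attr]
    (t : ι → Attr → V) (X Y : Finset Attr)
    (hX : IsMAS t X) (hY : IsMAS t Y) (hXY : X ≠ Y) :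
    (∀ i j : ι,
      ({k : ι | ∀ A ∈ X, t k A = t i A} ∩
        {k : ι | ∀ A ∈ Y, t k A = t j A}).Subsingleton) ∧
    (∀ i j : ι, i ≠ j → ¬ ∀ A ∈ X ∪ Y, t i A = t j A) := by
  have hunion : ∀ i j : ι, i ≠ j → ¬ ∀ A ∈ X ∪ Y, t i A = t j A := by
    intro i j hij h
    by_cases hYX : Y ⊆ X
    · exact hY.2 X (hYX.ssubset_of_ne hXY.symm)
        ⟨i, j, hij, fun A hA => h A (Finset.mem_union_left Y hA)⟩
    · exact hX.2 (X ∪ Y) (Finset.ssubset_iff_subset_ne.2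
        ⟨Finset.subset_union_left, fun he => hYX (Finset.union_eq_left.1 he.symm)⟩)
        ⟨i, j, hij, h⟩
  refine ⟨fun i j k hk l hl => ?_, hunion⟩
  by_contra hkl
  refine hunion k l hkl fun A hA => ?_
  rcases Finset.mem_union.1 hA with hA | hA
  · exact (hk.1 A hA).trans (hl.1 A hA).symm
  · exact (hk.2 A hA).trans (hl.2 A hA).symm
end

section
/- Let D be a dataset with records t i, let X be a nonempty attribute set and B an attribute. Let r* : Attr → V be a new record whose values on X are fresh, i.e., for every attribute A ∈ X and every record i of D, r* A ≠ t i A. Let D' be the dataset obtained from D by adjoining r* as a new record. Then the functional dependency X → {B} holds in D' if and only if it holds in D. (This is the claim, used in the proof of the paper's FD-preservation theorem, that adding fake non-collisional equivalence classes during the grouping step preserves FDs.) -/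
/-- Adding a fake record `rstar` whose values on the (nonempty) attribute set `X`
are fresh preserves the FD `X → {B}` in both directions: the FD holds in the
extended dataset iff it holds in the original one. -/
theorem adjoin_fresh_record_preserves_fd
    {ι Attr V : Type*} (t : ι → Attr → V) (X : Finset Attr) (hX : X.Nonempty)
    (B : Attr) (rstar : Attr → V)
    (hfresh : ∀ A ∈ X, ∀ i : ι, rstar A ≠ t i A) :
    (∀ i j : Option ι,
      (∀ A ∈ X, (Option.elim i rstar t) A = (Option.elim j rstar t) A) →
      (Option.elim i rstar t) B = (Option.elim j rstar t) B) ↔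
    (∀ i j : ι, (∀ A ∈ X, t i A = t j A) → t i B = t j B) := by
  obtain ⟨A, hA⟩ := hX
  refine ⟨fun h i j hij => h (some i) (some j) hij, fun h i j hij => ?_⟩
  cases i with
  | none =>
    cases j with
    | none => rfl
    | some j => exact absurd (hij A hA) (hfresh A hA j)
  | some i =>
    cases j with
    | none => exact absurd (hij A hA).symm (hfresh A hA i)
    | some j => exact h i j hij
end

section
/- Let D be a dataset over a finite attribute set Attr, X an attribute set and B ∉ X an attribute. Suppose the functional dependency X → {B} holds in D and there exist two distinct records of D that agree on X. Then there exists a maximal attribute set (MAS) M of D with X ∪ {B} ⊆ M. -/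
/-- The paper's claim: for every FD `X → {B}` of `D` (with `B ∉ X`) that is
witnessed by two distinct records agreeing on `X`, there exists a MAS `M` of `D`
with `X ∪ {B} ⊆ M`. -/
theorem fd_contained_in_some_mas
    {ι Attr V : Type*} [Fintype ι] [Fintype Attr] [DecidableEq Attr]
    (t : ι → Attr → V) (X : Finset Attr) (B : Attr) (hB : B ∉ X)
    (hFD : ∀ i j : ι, (∀ A ∈ X, t i A = t j A) → t i B = t j B)
    (hsupp : ∃ i j : ι, i ≠ j ∧ ∀ A ∈ X, t i A = t j A) :
    ∃ M : Finset Attr, IsMAS t M ∧ X ∪ {B} ⊆ M := by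
  obtain ⟨i, j, hij, hX⟩ := hsupp
  have hXB : ∃ i j : ι, i ≠ j ∧ ∀ A ∈ X ∪ {B}, t i A = t j A := by
    refine ⟨i, j, hij, fun A hA => ?_⟩
    rcases Finset.mem_union.1 hA with h | h
    · exact hX A h
    · rw [Finset.mem_singleton.1 h]
      exact hFD i j hX
  obtain ⟨M, hM, hmax⟩ := Finite.exists_le_maximal
    (p := fun Y : Finset Attr => ∃ i j : ι, i ≠ j ∧ ∀ A ∈ Y, t i A = t j A) hXB
  exact ⟨M, ⟨hmax.prop, fun _ hlt => hmax.not_prop_of_gt hlt⟩, hM⟩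
end

section
/- Let f₁ ≤ f₂ ≤ ⋯ ≤ f_k be a nondecreasing sequence of real numbers (the sizes of the equivalence classes of an equivalence class group, sorted in ascending order) and let m be a real number with m ≤ f_k (in Case 1 of the splitting-and-scaling step, m = ⌈f_k/ϖ⌉ for split factor ϖ ≥ 1). For 1 ≤ j ≤ k define the scaling cost R₁(j) = Σ_{i=1}^{j−1} (m − f_i) + Σ_{i=j}^{k} (f_k − f_i). Then R₁ is nonincreasing in j: for all 1 ≤ j ≤ j' ≤ k, R₁(j') ≤ R₁(j). Consequently, over any set J ⊆ {1,…,k} of admissible split points, R₁ is minimized at max J; in particular, in Case 1, R₁ is minimized at j = max{ j : f_{j−1} ≤ m }. (This is the optimality claim for the split point in the paper's splitting-and-scaling step.) -/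
/-- Case-1 scaling cost of the splitting-and-scaling step with split point `j`:
the classes `1, …, j−1` are not split (each must be scaled up to frequency `m`),
while the classes `j, …, k` are split (each must be scaled up to `f k`). -/
noncomputable def R1 (k : ℕ) (f : ℕ → ℝ) (m : ℝ) (j : ℕ) : ℝ :=
  (∑ i ∈ Finset.Icc 1 (j - 1), (m - f i)) + (∑ i ∈ Finset.Icc j k, (f k - f i))

/-- Moving the split point from `j` to `j + 1` changes the scaling cost by `m - f k`. -/
theorem R1_succ (k : ℕ) (f : ℕ → ℝ) (m : ℝ) {j : ℕ} (hj : 1 ≤ j) (hjk : j ≤ k) :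
    R1 k f m (j + 1) = R1 k f m j + (m - f k) := by
  obtain ⟨n, rfl⟩ := Nat.exists_eq_add_of_le' hj
  have hsplit : ∑ i ∈ Finset.Icc (n + 1) k, (f k - f i) =
      (f k - f (n + 1)) + ∑ i ∈ Finset.Icc (n + 1 + 1) k, (f k - f i) := by
    rw [← Finset.insert_Icc_add_one_left_eq_Icc hjk, Finset.sum_insert (by simp)]
  simp only [R1, Nat.add_sub_cancel]
  rw [hsplit, Finset.sum_Icc_succ_top (by omega)]
  ring

/-- The scaling cost is nonincreasing in the split point. -/
theorem R1_anti (k : ℕ) (f : ℕ → ℝ) (m : ℝ) (hm : m ≤ f k) {j j' : ℕ}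
    (hj : 1 ≤ j) (hjj' : j ≤ j') (hj' : j' ≤ k) : R1 k f m j' ≤ R1 k f m j := by
  induction j', hjj' using Nat.le_induction with
  | base => exact le_rfl
  | succ n hn ih =>
    have hstep := R1_succ k f m (hj.trans hn) (by omega : n ≤ k)
    linarith [ih (by omega)]

/-- Optimality of the split point in Case 1 of splitting-and-scaling: if
`f₁ ≤ ⋯ ≤ f_k` and `m ≤ f_k`, then `R₁` is nonincreasing in `j`; consequently,
over any set `J ⊆ {1,…,k}` of admissible split points it is minimized at `max J`,
in particular at `j = max { j : f_{j−1} ≤ m }`. -/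
theorem R1_optimal_split_point
    (k : ℕ) (hk : 1 ≤ k) (f : ℕ → ℝ) (m : ℝ)
    (hmono : ∀ i j : ℕ, 1 ≤ i → i ≤ j → j ≤ k → f i ≤ f j)
    (hm : m ≤ f k) :
    (∀ j j' : ℕ, 1 ≤ j → j ≤ j' → j' ≤ k → R1 k f m j' ≤ R1 k f m j) ∧
    (∀ (J : Finset ℕ) (hJ : J.Nonempty), J ⊆ Finset.Icc 1 k →
      ∀ j ∈ J, R1 k f m (J.max' hJ) ≤ R1 k f m j) ∧
    (∀ (hS : ((Finset.Icc 1 k).filter (fun j => f (j - 1) ≤ m)).Nonempty),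
      ∀ j ∈ (Finset.Icc 1 k).filter (fun j => f (j - 1) ≤ m),
        R1 k f m (((Finset.Icc 1 k).filter (fun j => f (j - 1) ≤ m)).max' hS) ≤
          R1 k f m j) := by
  have hmax : ∀ (J : Finset ℕ) (hJ : J.Nonempty), J ⊆ Finset.Icc 1 k →
      ∀ j ∈ J, R1 k f m (J.max' hJ) ≤ R1 k f m j := fun J hJ hJk j hj =>
    R1_anti k f m hm (Finset.mem_Icc.mp (hJk hj)).1 (J.le_max' j hj)
      (Finset.mem_Icc.mp (hJk (J.max'_mem hJ))).2
  exact ⟨fun _ _ => R1_anti k f m hm, hmax, fun hS => hmax _ hS (Finset.filter_subset _ _)⟩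
end
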